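/- Let X = (x_n)_{n∈ℕ} be a subsymmetric basis of a real or complex Banach space X with nontrivial Rademacher cotype. Then X admits an equivalent norm with respect to which X is isometrically greedy, isometrically bidemocratic, and isometrically subsymmetric. Moreover, there exists a Dini regularization σ of φ_u[X] with σ and σ* nondecreasing, and for any such σ the equivalent norm can be chosen so that the fundamental function of X relative to it equals σ. -/

import Mathlib

open scoped BigOperators ENNReal NNReal
open MeasureTheory

noncomputable section

namespace GreedyRenorm

/-! ### Sequence notions.  Sequences are indexed by `ℕ`, understood as defined on the
positive integers, with the convention that the value at `0` is `0` where relevant. -/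

/-- `σ` is nondecreasing (on the positive integers). -/
def MonoFrom1 (σ : ℕ → ℝ) : Prop := ∀ m : ℕ, 1 ≤ m → σ m ≤ σ (m + 1)

/-- The dual sequence `σ*(m) = m / σ(m)` is nondecreasing (on the positive integers). -/
def DualMonoFrom1 (σ : ℕ → ℝ) : Prop :=
  ∀ m : ℕ, 1 ≤ m → (m : ℝ) / σ m ≤ ((m : ℝ) + 1) / σ (m + 1)

/-- Lower regularity property: `σ (r m) ≥ 2 σ m` for some positive integer `r`. -/
def HasLRP (σ : ℕ → ℝ) : Prop :=
  ∃ r : ℕ, 1 ≤ r ∧ ∀ m : ℕ, 1 ≤ m → 2 * σ m ≤ σ (r * m)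

/-- Upper regularity property: `σ (r m) ≤ (r/2) σ m` for some positive integer `r`. -/
def HasURP (σ : ℕ → ℝ) : Prop :=
  ∃ r : ℕ, 1 ≤ r ∧ ∀ m : ℕ, 1 ≤ m → σ (r * m) ≤ ((r : ℝ) / 2) * σ m

/-- Dini regularity: the discrete derivative of `σ` is equivalent to `σ(m)/m`. -/
def DiniRegular (σ : ℕ → ℝ) : Prop :=
  ∃ C : ℝ, 1 ≤ C ∧ ∀ m : ℕ, 1 ≤ m →
    (1 / C) * (σ m / (m : ℝ)) ≤ σ m - σ (m - 1) ∧
      σ m - σ (m - 1) ≤ C * (σ m / (m : ℝ))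

/-- `σ` and `τ` are equivalent sequences (on the positive integers). -/
def EquivSeq (σ τ : ℕ → ℝ) : Prop :=
  ∃ D : ℝ, 1 ≤ D ∧ ∀ m : ℕ, 1 ≤ m → (1 / D) * τ m ≤ σ m ∧ σ m ≤ D * τ m

/-- `σ` is a Dini regularization of `τ`: it is Dini-regular and equivalent to `τ`
(with the convention `σ 0 = 0`). -/
def DiniRegularization (σ τ : ℕ → ℝ) : Prop :=
  σ 0 = 0 ∧ DiniRegular σ ∧ EquivSeq σ τ

/-- A Dini regularization of `τ` which is positive and such that both it and its dual
sequence are nondecreasing. -/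
def GoodDiniReg (σ τ : ℕ → ℝ) : Prop :=
  DiniRegularization σ τ ∧ (∀ m : ℕ, 1 ≤ m → 0 < σ m) ∧ MonoFrom1 σ ∧ DualMonoFrom1 σ

/-! ### Fundamental functions and norms -/

/-- The fundamental function of a family `y` computed with respect to a gauge `ν`:
`m ↦ sup { ν (∑_{n ∈ A} ε n • y n) : |A| ≤ m, |ε n| = 1 }`. -/
def fundFunWith (𝕜 : Type*) [RCLike 𝕜] {N Y : Type*} [AddCommGroup Y] [Module 𝕜 Y]
    (ν : Y → ℝ) (y : N → Y) (m : ℕ) : ℝ :=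
  sSup {r : ℝ | ∃ (A : Finset N) (ε : N → 𝕜), A.card ≤ m ∧ (∀ n, ‖ε n‖ = 1) ∧
    r = ν (∑ n ∈ A, ε n • y n)}

/-- The fundamental function of a family `y` in a normed space. -/
def fundFun (𝕜 : Type*) [RCLike 𝕜] {N Y : Type*} [SeminormedAddCommGroup Y]
    [NormedSpace 𝕜 Y] (y : N → Y) (m : ℕ) : ℝ :=
  fundFunWith 𝕜 (fun v => ‖v‖) y m

/-- `ν` is an equivalent norm on the normed space `X`. -/
structure IsEquivNorm (𝕜 : Type*) [RCLike 𝕜] {X : Type*} [NormedAddCommGroup X]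
    [NormedSpace 𝕜 X] (ν : X → ℝ) : Prop where
  add_le : ∀ f g : X, ν (f + g) ≤ ν f + ν g
  smul_eq : ∀ (a : 𝕜) (f : X), ν (a • f) = ‖a‖ * ν f
  lower : ∃ c : ℝ, 0 < c ∧ ∀ f : X, c * ‖f‖ ≤ ν f
  upper : ∃ C : ℝ, 0 < C ∧ ∀ f : X, ν f ≤ C * ‖f‖

section Basis

variable {𝕜 : Type*} [RCLike 𝕜] {N : Type*} {X : Type*}
  [NormedAddCommGroup X] [NormedSpace 𝕜 X]

/-- The dual norm, relative to the gauge `ν` on `X`, of a functional `g`. -/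
def dualNormWith (ν : X → ℝ) (g : X →L[𝕜] 𝕜) : ℝ :=
  sSup {r : ℝ | ∃ f : X, ν f ≤ 1 ∧ r = ‖g f‖}

/-- The fundamental function of the dual system `xs`, computed with the dual norm of `ν`. -/
def dualFundFunWith (ν : X → ℝ) (xs : N → X →L[𝕜] 𝕜) (m : ℕ) : ℝ :=
  sSup {r : ℝ | ∃ (B : Finset N) (δ : N → 𝕜), B.card ≤ m ∧ (∀ n, ‖δ n‖ = 1) ∧
    r = dualNormWith ν (∑ n ∈ B, δ n • xs n)}

/-- `A` is a greedy set of `f` with respect to the coordinate functionals `xs`. -/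
def GreedySet (xs : N → X →L[𝕜] 𝕜) (f : X) (A : Finset N) : Prop :=
  ∀ n ∈ A, ∀ k, k ∉ A → ‖xs k f‖ ≤ ‖xs n f‖

/-- `S_A(f) = ∑_{n ∈ A} x_n^*(f) • x_n`. -/
def greedyProj (x : N → X) (xs : N → X →L[𝕜] 𝕜) (A : Finset N) (f : X) : X :=
  ∑ n ∈ A, xs n f • x n

/-- A complete minimal system with its (biorthogonal) dual system. -/
structure IsCompleteMinimal (x : N → X) (xs : N → X →L[𝕜] 𝕜) : Prop where
  dense_span : (Submodule.span 𝕜 (Set.range x)).topologicalClosure = ⊤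
  biorth_diag : ∀ n, xs n (x n) = 1
  biorth_off : ∀ n k, n ≠ k → xs n (x k) = 0

/-- A basis: a complete minimal system which is semi-normalized and `M`-bounded. -/
structure IsBasis (x : N → X) (xs : N → X →L[𝕜] 𝕜) : Prop where
  dense_span : (Submodule.span 𝕜 (Set.range x)).topologicalClosure = ⊤
  biorth_diag : ∀ n, xs n (x n) = 1
  biorth_off : ∀ n k, n ≠ k → xs n (x k) = 0
  norm_pos : ∃ c : ℝ, 0 < c ∧ ∀ n, c ≤ ‖x n‖
  norm_bdd : ∃ C : ℝ, ∀ n, ‖x n‖ ≤ C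
  mBounded : ∃ C : ℝ, ∀ n, ‖x n‖ * ‖xs n‖ ≤ C

/-- The basis is `C`-greedy with respect to the gauge `ν`. -/
def GreedyWith (ν : X → ℝ) (x : N → X) (xs : N → X →L[𝕜] 𝕜) (C : ℝ) : Prop :=
  ∀ (f : X) (A B : Finset N) (a : N → 𝕜), GreedySet xs f A → B.card ≤ A.card →
    ν (f - greedyProj x xs A f) ≤ C * ν (f - ∑ n ∈ B, a n • x n)

/-- The basis is `C`-almost greedy with respect to the gauge `ν`. -/
def AlmostGreedyWith (ν : X → ℝ) (x : N → X) (xs : N → X →L[𝕜] 𝕜) (C : ℝ) : Prop :=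
  ∀ (f : X) (A B : Finset N), GreedySet xs f A → B.card ≤ A.card →
    ν (f - greedyProj x xs A f) ≤ C * ν (f - greedyProj x xs B f)

/-- The basis is `C`-quasi-greedy with respect to the gauge `ν`. -/
def QuasiGreedyWith (ν : X → ℝ) (x : N → X) (xs : N → X →L[𝕜] 𝕜) (C : ℝ) : Prop :=
  ∀ (f : X) (A : Finset N), GreedySet xs f A → ν (greedyProj x xs A f) ≤ C * ν f

/-- The basis is lattice `C`-unconditional with respect to the gauge `ν`. -/
def LatticeUnconditionalWith (ν : X → ℝ) (x : N → X) (xs : N → X →L[𝕜] 𝕜) (C : ℝ) : Prop :=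
  ∀ (f : X) (A : Finset N) (lam : N → 𝕜) (M : ℝ), (∀ n, ‖lam n‖ ≤ M) →
    ν (∑ n ∈ A, lam n • xs n f • x n) ≤ C * M * ν f

/-- The basis is suppression `C`-unconditional (with respect to the ambient norm). -/
def SuppressionUnconditional (x : N → X) (xs : N → X →L[𝕜] 𝕜) (C : ℝ) : Prop :=
  ∀ (f : X) (A : Finset N), ‖greedyProj x xs A f‖ ≤ C * ‖f‖

/-- The family `x` is `C`-democratic (with respect to the ambient norm). -/
def Democratic (x : N → X) (C : ℝ) : Prop :=
  ∀ A B : Finset N, A.card ≤ B.card → ‖∑ n ∈ A, x n‖ ≤ C * ‖∑ n ∈ B, x n‖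

/-- The basis is `C`-bidemocratic (with respect to the ambient norm; the dual system
carries the operator norm). -/
def Bidemocratic (x : N → X) (xs : N → X →L[𝕜] 𝕜) (C : ℝ) : Prop :=
  ∀ (A B : Finset N) (ε δ : N → 𝕜), (∀ n, ‖ε n‖ = 1) → (∀ n, ‖δ n‖ = 1) →
    ‖∑ n ∈ A, ε n • x n‖ * ‖∑ n ∈ B, δ n • xs n‖ ≤ C * (max A.card B.card : ℕ)

/-- The basis is `C`-bidemocratic with respect to the gauge `ν` (the dual system carries
the corresponding dual norm). -/
def BidemocraticWith (ν : X → ℝ) (x : N → X) (xs : N → X →L[𝕜] 𝕜) (C : ℝ) : Prop :=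
  ∀ (A B : Finset N) (ε δ : N → 𝕜), (∀ n, ‖ε n‖ = 1) → (∀ n, ‖δ n‖ = 1) →
    ν (∑ n ∈ A, ε n • x n) * dualNormWith ν (∑ n ∈ B, δ n • xs n) ≤
      C * (max A.card B.card : ℕ)

/-- Property (A) with respect to the gauge `ν`. -/
def PropertyAWith (ν : X → ℝ) (x : N → X) (xs : N → X →L[𝕜] 𝕜) : Prop :=
  ∀ (A B : Finset N) (ε δ : N → 𝕜) (g : X),
    A.card ≤ B.card → Disjoint A B → (∀ n, ‖ε n‖ = 1) → (∀ n, ‖δ n‖ = 1) →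
    (∀ n, (n ∈ A ∨ n ∈ B) → xs n g = 0) → (∀ n, ‖xs n g‖ ≤ 1) →
    ν ((∑ n ∈ A, ε n • x n) + g) ≤ ν ((∑ n ∈ B, δ n • x n) + g)

end Basis

/-- The basis `x` (indexed by `ℕ`) is `C`-subsymmetric with respect to the gauge `ν`:
every "dilated sign change" extends to an isomorphism onto its range with distortion
constants at most `C`. -/
def SubsymWith (𝕜 : Type*) [RCLike 𝕜] {X : Type*} [NormedAddCommGroup X]
    [NormedSpace 𝕜 X] (ν : X → ℝ) (x : ℕ → X) (C : ℝ) : Prop :=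
  ∀ (lam : ℕ → 𝕜), (∀ n, ‖lam n‖ = 1) → ∀ β : ℕ → ℕ, StrictMono β →
    ∃ T : X →L[𝕜] X, (∀ n, T (x n) = lam n • x (β n)) ∧
      (∀ f : X, ν (T f) ≤ C * ν f) ∧ (∀ f : X, ν f ≤ C * ν (T f))

/-- `X` has nontrivial Rademacher cotype. -/
def NontrivialCotype (X : Type*) [SeminormedAddCommGroup X] : Prop :=
  ∃ q C : ℝ, 0 < q ∧ 0 < C ∧ ∀ (n : ℕ) (f : Fin n → X),
    (∑ i, ‖f i‖ ^ q) ^ (1 / q) ≤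
      C * (((2 : ℝ) ^ n)⁻¹ * ∑ ε : Fin n → Bool, ‖∑ i, (if ε i then f i else -f i)‖)

/-- `X` has nontrivial Rademacher type. -/
def NontrivialType (X : Type*) [SeminormedAddCommGroup X] : Prop :=
  ∃ p C : ℝ, 1 < p ∧ 0 < C ∧ ∀ (n : ℕ) (f : Fin n → X),
    ((2 : ℝ) ^ n)⁻¹ * ∑ ε : Fin n → Bool, ‖∑ i, (if ε i then f i else -f i)‖ ≤
      C * (∑ i, ‖f i‖ ^ p) ^ (1 / p)

end GreedyRenorm
namespace GreedyRenorm

/-! ### Testing functionals -/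

/-- Data of a positive testing functional on nonnegative sequences: the weight `σ k / k` on `A`,
and the weights `b` on `F \ A`. -/
structure Tester where
  k : ℕ
  A : Finset ℕ
  F : Finset ℕ
  b : ℕ → ℝ

namespace Tester

/-- The value of the testing functional at the sequence `u`. -/
def val (σ : ℕ → ℝ) (g : Tester) (u : ℕ → ℝ) : ℝ :=
  σ g.k / g.k * ∑ n ∈ g.A, u n + ∑ n ∈ g.F \ g.A, g.b n * u n

/-- Admissibility of testing functionals, relative to a family `S` of weights. -/
structure Admissible (σ : ℕ → ℝ) (η : ℝ) (S : Set (ℕ → ℝ)) (g : Tester) : Prop where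
  one_le : 1 ≤ g.k
  card_le : g.A.card ≤ g.k
  mem : g.b ∈ S
  le : ∀ n, g.b n ≤ η * (σ g.k / g.k)

end Tester

/-- The compatibility conditions between `σ`, `η` and the family `S` of weights under which the
norm defined by admissible testing functionals is well behaved. -/
structure Compatible (σ : ℕ → ℝ) (η : ℝ) (S : Set (ℕ → ℝ)) : Prop where
  pos : ∀ m, 1 ≤ m → 0 < σ m
  mono : MonoFrom1 σ
  dual : DualMonoFrom1 σ
  eta_pos : 0 < η
  eta_le : η ≤ 1
  lower : ∀ m, 1 ≤ m → 3 * η * (σ (m + 1) / (m + 1 : ℕ)) ≤ σ (m + 1) - σ m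
  nonneg : ∀ b ∈ S, ∀ n, 0 ≤ b n
  solid : ∀ b ∈ S, ∀ b' : ℕ → ℝ, (∀ n, 0 ≤ b' n) → (∀ n, b' n ≤ b n) → b' ∈ S
  sum_le : ∀ b ∈ S, ∀ D : Finset ℕ, D.Nonempty → ∑ n ∈ D, b n ≤ η * σ D.card

namespace Compatible

variable {σ : ℕ → ℝ} {η : ℝ} {S : Set (ℕ → ℝ)}

lemma div_nonneg (h : Compatible σ η S) {k : ℕ} (hk : 1 ≤ k) : 0 ≤ σ k / k :=
  _root_.div_nonneg (h.pos k hk).le (Nat.cast_nonneg k)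

lemma monotone (h : Compatible σ η S) {j k : ℕ} (hj : 1 ≤ j) (hjk : j ≤ k) : σ j ≤ σ k := by
  induction k, hjk using Nat.le_induction with
  | base => exact le_rfl
  | succ k hk ih => exact ih.trans (h.mono k (hj.trans hk))

lemma div_succ_le (h : Compatible σ η S) {k : ℕ} (hk : 1 ≤ k) :
    σ (k + 1) / (k + 1 : ℕ) ≤ σ k / k := by
  have h1 := h.dual k hk
  have hk0 : (0 : ℝ) < k := by exact_mod_cast hk
  have hk1 : (0 : ℝ) < (k + 1 : ℕ) := by positivity
  rw [div_le_div_iff₀ (h.pos k hk) (h.pos (k + 1) (by omega))] at h1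
  rw [div_le_div_iff₀ hk1 hk0]
  push_cast
  linarith

lemma antitone_div (h : Compatible σ η S) {j k : ℕ} (hj : 1 ≤ j) (hjk : j ≤ k) :
    σ k / k ≤ σ j / j := by
  induction k, hjk using Nat.le_induction with
  | base => exact le_rfl
  | succ k hk ih => exact (h.div_succ_le (hj.trans hk)).trans ih

lemma val_nonneg (h : Compatible σ η S) {g : Tester} (hg : g.Admissible σ η S) {u : ℕ → ℝ}
    (hu : ∀ n, 0 ≤ u n) : 0 ≤ g.val σ u :=
  add_nonneg (mul_nonneg (h.div_nonneg hg.one_le) (Finset.sum_nonneg fun n _ => hu n))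
    (Finset.sum_nonneg fun n _ => mul_nonneg (h.nonneg _ hg.mem n) (hu n))

lemma val_mono (h : Compatible σ η S) {g : Tester} (hg : g.Admissible σ η S) {u v : ℕ → ℝ}
    (huv : ∀ n, u n ≤ v n) : g.val σ u ≤ g.val σ v := by
  refine add_le_add (mul_le_mul_of_nonneg_left (Finset.sum_le_sum fun n _ => huv n)
    (h.div_nonneg hg.one_le)) (Finset.sum_le_sum fun n _ => ?_)
  exact mul_le_mul_of_nonneg_left (huv n) (h.nonneg _ hg.mem n)

/-- Weights exceeding `η σ(k+1)/(k+1)` occur at most `k` times. -/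
lemma card_large_le (h : Compatible σ η S) {b : ℕ → ℝ} (hb : b ∈ S) {k : ℕ} {T : Finset ℕ}
    (hT : ∀ n ∈ T, η * (σ (k + 1) / (k + 1 : ℕ)) < b n) : T.card ≤ k := by
  by_contra! hk
  have hne : T.Nonempty := Finset.card_pos.1 (by omega)
  have h1 := h.sum_le b hb T hne
  have h2 : ∑ n ∈ T, η * (σ (k + 1) / (k + 1 : ℕ)) < ∑ n ∈ T, b n :=
    Finset.sum_lt_sum_of_nonempty hne hT
  have h3 := h.antitone_div (show 1 ≤ k + 1 by omega) hk
  have hc : (0 : ℝ) < T.card := by exact_mod_cast hne.card_pos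
  rw [Finset.sum_const, nsmul_eq_mul] at h2
  have h4 : σ T.card = T.card * (σ T.card / T.card) := by field_simp
  rw [h4] at h1
  have h5 : η * (T.card * (σ T.card / T.card)) ≤ η * (T.card * (σ (k + 1) / (k + 1 : ℕ))) :=
    mul_le_mul_of_nonneg_left (mul_le_mul_of_nonneg_left h3 hc.le) h.eta_pos.le
  linarith

/-- A coordinate of maximal size can be moved into the main set of a testing functional. -/
lemma exists_insert (h : Compatible σ η S) {u : ℕ → ℝ} {t : ℝ} (hu0 : ∀ n, 0 ≤ u n)
    (hut : ∀ n, u n ≤ t) {i : ℕ} (hi : u i = t) {g : Tester} (hg : g.Admissible σ η S) :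
    ∃ g' : Tester, g'.Admissible σ η S ∧ g'.A = insert i g.A ∧ g.val σ u ≤ g'.val σ u := by
  obtain ⟨k, A, F, b⟩ := g
  obtain ⟨h1, hA, hb, hle⟩ := hg
  dsimp only at h1 hA hb hle
  have ht : 0 ≤ t := (hu0 i).trans (hut i)
  have hb0 := h.nonneg b hb
  have hsk := h.div_nonneg h1
  by_cases hiA : i ∈ A
  · exact ⟨⟨k, A, F, b⟩, ⟨h1, hA, hb, hle⟩, by simp [hiA], le_rfl⟩
  have hF : F \ insert i A = (F \ A).erase i := by
    ext n; simp only [Finset.mem_sdiff, Finset.mem_insert, Finset.mem_erase]; tauto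
  have hsum : ∑ n ∈ F \ A, b n * u n ≤ b i * t + ∑ n ∈ (F \ A).erase i, b n * u n := by
    by_cases hiF : i ∈ F \ A
    · rw [← Finset.add_sum_erase _ _ hiF, hi]
    · rw [Finset.erase_eq_of_notMem hiF]
      have := mul_nonneg (hb0 i) ht
      linarith
  rcases hA.lt_or_eq with hlt | heq
  · refine ⟨⟨k, insert i A, F, b⟩, ⟨h1, ?_, hb, hle⟩, rfl, ?_⟩
    · simp only [Finset.card_insert_of_notMem hiA]; omega
    · simp only [Tester.val, hF, Finset.sum_insert hiA, hi]
      have h2 : b i * t ≤ σ k / k * t := by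
        refine mul_le_mul_of_nonneg_right ((hle i).trans ?_) ht
        nlinarith [h.eta_le]
      linarith
  · set a := σ k / k with ha
    set c := σ (k + 1) / (k + 1 : ℕ) with hc
    have hca : c ≤ a := h.div_succ_le h1
    have hc0 : 0 ≤ c := h.div_nonneg (by omega)
    have hη := h.eta_pos
    have hk0 : (0 : ℝ) < k := by exact_mod_cast h1
    have e1 : σ k = k * a := by rw [ha]; field_simp
    have e2 : σ (k + 1) = (k + 1) * c := by rw [hc]; push_cast; field_simp
    have hlow := h.lower k h1
    have hmono := h.mono k h1
    rw [← hc, e1, e2] at hlow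
    rw [e1, e2] at hmono
    refine ⟨⟨k + 1, insert i A, F, fun n => min (b n) (η * c)⟩, ⟨by simp, ?_, ?_, ?_⟩, rfl, ?_⟩
    · simp only [Finset.card_insert_of_notMem hiA]; omega
    · exact h.solid b hb _ (fun n => le_min (hb0 n) (by positivity)) fun n => min_le_left _ _
    · exact fun n => min_le_right _ _
    · simp only [Tester.val, hF, Finset.sum_insert hiA, hi]
      rw [← ha, ← hc]
      set E := (F \ A).erase i with hE
      set T := E.filter (fun n => η * c < b n) with hT
      have hTk : (T.card : ℝ) ≤ k := by
        exact_mod_cast h.card_large_le hb (fun n hn => (Finset.mem_filter.1 hn).2)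
      have hloss : ∑ n ∈ E, b n * u n - ∑ n ∈ E, min (b n) (η * c) * u n
          ≤ k * (η * (a - c) * t) := by
        rw [← Finset.sum_sub_distrib]
        have : ∀ n ∈ E, b n * u n - min (b n) (η * c) * u n
            ≤ if η * c < b n then η * (a - c) * t else 0 := by
          intro n _
          split_ifs with hn
          · rw [min_eq_right hn.le, ← sub_mul]
            have hx : b n - η * c ≤ η * (a - c) := by have := hle n; linarith
            have hy : 0 ≤ b n - η * c := by linarith
            exact mul_le_mul hx (hut n) (hu0 n) (hy.trans hx)
          · rw [min_eq_left (not_lt.1 hn)]; simp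
        refine (Finset.sum_le_sum this).trans ?_
        rw [← Finset.sum_filter, Finset.sum_const, nsmul_eq_mul]
        have : 0 ≤ η * (a - c) * t := mul_nonneg (mul_nonneg hη.le (by linarith)) ht
        exact mul_le_mul_of_nonneg_right hTk this
      have hAsum : ∑ n ∈ A, u n ≤ k * t := by
        refine (Finset.sum_le_sum fun n _ => hut n).trans ?_
        rw [Finset.sum_const, nsmul_eq_mul, heq]
      have hA2 : (a - c) * ∑ n ∈ A, u n ≤ (a - c) * (k * t) :=
        mul_le_mul_of_nonneg_left hAsum (by linarith)
      have hbi : b i * t ≤ η * a * t := mul_le_mul_of_nonneg_right (hle i) ht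
      have ha2 : a ≤ 2 * c := by
        have : (k + 1 : ℝ) ≤ 2 * k := by
          have : (1 : ℝ) ≤ k := by exact_mod_cast h1
          linarith
        have : (k + 1) * c ≤ 2 * k * c := mul_le_mul_of_nonneg_right this hc0
        have : k * a ≤ k * (2 * c) := by linarith
        exact le_of_mul_le_mul_left this hk0
      have hfin : 0 ≤ c - k * (a - c) - k * (η * (a - c)) - η * a := by
        have : η * (k * (a - c)) ≤ η * c := mul_le_mul_of_nonneg_left (by linarith) hη.le
        have : η * a ≤ η * (2 * c) := mul_le_mul_of_nonneg_left ha2 hη.le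
        linarith
      have := mul_nonneg hfin ht
      linarith

lemma exists_superset (h : Compatible σ η S) {u : ℕ → ℝ} {t : ℝ} (hu0 : ∀ n, 0 ≤ u n)
    (hut : ∀ n, u n ≤ t) (P : Finset ℕ) (hP : ∀ i ∈ P, u i = t) {g : Tester}
    (hg : g.Admissible σ η S) :
    ∃ g' : Tester, g'.Admissible σ η S ∧ P ⊆ g'.A ∧ g.val σ u ≤ g'.val σ u := by
  induction P using Finset.induction_on with
  | empty => exact ⟨g, hg, by simp, le_rfl⟩
  | insert i P _ ih =>
    obtain ⟨g₁, hg₁, hP₁, hle₁⟩ := ih fun j hj => hP j (Finset.mem_insert_of_mem hj)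
    obtain ⟨g₂, hg₂, hA₂, hle₂⟩ := h.exists_insert hu0 hut (hP i (Finset.mem_insert_self i P)) hg₁
    refine ⟨g₂, hg₂, ?_, hle₁.trans hle₂⟩
    rw [hA₂]
    exact Finset.insert_subset_insert i hP₁

/-- Indicators of sets of cardinality `m` have norm at most `σ m`. -/
lemma val_indicator_le (h : Compatible σ η S) {D : Finset ℕ} (hD : D.Nonempty) {g : Tester}
    (hg : g.Admissible σ η S) : g.val σ (fun n => if n ∈ D then 1 else 0) ≤ σ D.card := by
  obtain ⟨g', hg', hsub, hle⟩ := h.exists_superset (u := fun n => if n ∈ D then (1 : ℝ) else 0)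
    (t := 1) (fun n => by split_ifs <;> norm_num) (fun n => by split_ifs <;> norm_num) D
    (fun i hi => by simp [hi]) hg
  refine hle.trans ?_
  have h1 : ∑ n ∈ g'.F \ g'.A, g'.b n * (if n ∈ D then (1 : ℝ) else 0) = 0 := by
    refine Finset.sum_eq_zero fun n hn => ?_
    rw [if_neg fun hnD => (Finset.mem_sdiff.1 hn).2 (hsub hnD), mul_zero]
  have h2 : ∑ n ∈ g'.A, (if n ∈ D then (1 : ℝ) else 0) = D.card := by
    rw [Finset.sum_ite_mem, Finset.inter_eq_right.2 hsub]; simp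
  rw [Tester.val, h1, h2, add_zero]
  have hc : (0 : ℝ) < D.card := by exact_mod_cast hD.card_pos
  have h3 := h.antitone_div hD.card_pos ((Finset.card_le_card hsub).trans hg'.card_le)
  calc σ g'.k / g'.k * D.card ≤ σ D.card / D.card * D.card :=
        mul_le_mul_of_nonneg_right h3 hc.le
    _ = σ D.card := by field_simp

/-- The exchange property behind isometric greediness. -/
lemma exists_exchange (h : Compatible σ η S) {u v : ℕ → ℝ} {t : ℝ} (hu0 : ∀ n, 0 ≤ u n)
    (hut : ∀ n, u n ≤ t) (hv0 : ∀ n, 0 ≤ v n) {P Q : Finset ℕ} (hPQ : P.card ≤ Q.card)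
    (hdisj : Disjoint P Q) (huQ : ∀ n ∈ Q, u n = 0) (hvQ : ∀ n ∈ Q, t ≤ v n)
    (huv : ∀ n, n ∉ P → n ∉ Q → u n ≤ v n) {g : Tester} (hg : g.Admissible σ η S) :
    ∃ g' : Tester, g'.Admissible σ η S ∧ g.val σ u ≤ g'.val σ v := by
  obtain ⟨Q', hQ', hcard⟩ := Finset.exists_subset_card_eq hPQ
  have ht : 0 ≤ t := (hu0 0).trans (hut 0)
  set w : ℕ → ℝ := fun n => if n ∈ P then t else u n with hw
  have hw0 : ∀ n, 0 ≤ w n := fun n => by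
    simp only [hw]; split_ifs
    exacts [ht, hu0 n]
  have hwt : ∀ n, w n ≤ t := fun n => by
    simp only [hw]; split_ifs
    exacts [le_rfl, hut n]
  have huw : ∀ n, u n ≤ w n := fun n => by
    simp only [hw]; split_ifs
    exacts [hut n, le_rfl]
  obtain ⟨⟨k, A, F, b⟩, hg', hPA, hle⟩ :=
    h.exists_superset hw0 hwt P (fun i hi => by simp [hw, hi]) hg
  have hgw := (h.val_mono hg huw).trans hle
  have hb0 := h.nonneg b hg'.mem
  have hs := h.div_nonneg hg'.one_le
  dsimp only at hPA hs
  have hwQ : ∀ n ∈ Q, w n = 0 := fun n hn => by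
    have : n ∉ P := Finset.disjoint_right.1 hdisj hn
    simp [hw, this, huQ n hn]
  have hwv : ∀ n, n ∉ P → w n ≤ v n := fun n hn => by
    by_cases hnQ : n ∈ Q
    · rw [hwQ n hnQ]; exact hv0 n
    · simpa [hw, hn] using huv n hn hnQ
  refine ⟨⟨k, (A \ P) \ Q' ∪ Q', (F \ A) \ Q', b⟩, ⟨hg'.one_le, ?_, hg'.mem, hg'.le⟩,
    hgw.trans ?_⟩
  · refine le_trans (Finset.card_union_le _ _) (le_trans ?_ hg'.card_le)
    have := Finset.card_le_card (Finset.sdiff_subset : (A \ P) \ Q' ⊆ A \ P)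
    have h2 := Finset.card_sdiff_add_card_eq_card hPA
    dsimp only at this h2 ⊢
    omega
  · simp only [Tester.val]
    refine add_le_add (mul_le_mul_of_nonneg_left ?_ hs) ?_
    · rw [Finset.sum_union Finset.sdiff_disjoint, ← Finset.sum_sdiff hPA]
      have e1 : ∑ n ∈ P, w n = P.card * t := by
        rw [Finset.sum_congr rfl (fun n hn => show w n = t by simp [hw, hn])]; simp
      have e2 : P.card * t ≤ ∑ n ∈ Q', v n := by
        rw [← hcard, ← nsmul_eq_mul, ← Finset.sum_const]
        exact Finset.sum_le_sum fun n hn => hvQ n (hQ' hn)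
      have e3 : ∑ n ∈ A \ P, w n ≤ ∑ n ∈ (A \ P) \ Q', v n := by
        rw [← Finset.sum_subset (Finset.sdiff_subset : (A \ P) \ Q' ⊆ A \ P)]
        · refine Finset.sum_le_sum fun n hn => hwv n ?_
          simp only [Finset.mem_sdiff] at hn; exact hn.1.2
        · intro n hn hn'
          refine hwQ n (hQ' ?_)
          by_contra hc
          exact hn' (Finset.mem_sdiff.2 ⟨hn, hc⟩)
      linarith
    · have hset : ((F \ A) \ Q') \ ((A \ P) \ Q' ∪ Q') = (F \ A) \ Q' := by
        ext n; simp only [Finset.mem_sdiff, Finset.mem_union]; tauto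
      rw [hset, ← Finset.sum_subset (Finset.sdiff_subset : (F \ A) \ Q' ⊆ F \ A)]
      · refine Finset.sum_le_sum fun n hn => mul_le_mul_of_nonneg_left (hwv n fun hP => ?_) (hb0 n)
        simp only [Finset.mem_sdiff] at hn
        exact hn.1.2 (hPA hP)
      · intro n hn hn'
        rw [hwQ n (hQ' ?_), mul_zero]
        by_contra hc
        exact hn' (Finset.mem_sdiff.2 ⟨hn, hc⟩)

end Compatible

/-! ### Subsymmetric bases -/

lemma exists_strictMono_comp_eq {ι : Type*} [LinearOrder ι] (F : Finset ι) {p q : ι → ℕ}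
    (hp : StrictMonoOn p F) (hq : StrictMonoOn q F) :
    ∃ β γ : ℕ → ℕ, StrictMono β ∧ StrictMono γ ∧ ∀ i ∈ F, β (p i) = γ (q i) := by
  have key : ∀ p q : ι → ℕ, StrictMono fun n => n + (F.filter (fun i => p i ≤ n)).sup q := by
    intro p q a b hab
    refine add_lt_add_of_lt_of_le hab (Finset.sup_mono fun i hi => ?_)
    rw [Finset.mem_filter] at hi ⊢
    exact ⟨hi.1, hi.2.trans hab.le⟩
  have key2 : ∀ p q : ι → ℕ, StrictMonoOn p F → StrictMonoOn q F → ∀ i ∈ F,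
      (F.filter (fun j => p j ≤ p i)).sup q = q i := by
    intro p q hp hq i hi
    refine le_antisymm (Finset.sup_le fun j hj => ?_)
      (Finset.le_sup (f := q) (Finset.mem_filter.2 ⟨hi, le_rfl⟩))
    rw [Finset.mem_filter] at hj
    exact (hq.le_iff_le hj.1 hi).2 ((hp.le_iff_le hj.1 hi).1 hj.2)
  refine ⟨_, _, key p q, key q p, fun i hi => ?_⟩
  rw [key2 p q hp hq i hi, key2 q p hq hp i hi, add_comm]

section Subsymmetric

variable {𝕜 : Type*} [RCLike 𝕜] {X : Type*} [NormedAddCommGroup X] [NormedSpace 𝕜 X]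
  {x : ℕ → X} {xs : ℕ → X →L[𝕜] 𝕜}

lemma IsBasis.dense (hb : IsBasis x xs) :
    Dense (Submodule.span 𝕜 (Set.range x) : Set X) := by
  rw [Submodule.dense_iff_topologicalClosure_eq_top]
  exact hb.dense_span

lemma IsBasis.ext {Y : Type*} [NormedAddCommGroup Y] [NormedSpace 𝕜 Y] (hb : IsBasis x xs)
    {T T' : X →L[𝕜] Y} (h : ∀ n, T (x n) = T' (x n)) : T = T' := by
  refine ContinuousLinearMap.ext_on hb.dense ?_
  rintro _ ⟨n, rfl⟩
  exact h n

lemma IsBasis.coord_apply (hb : IsBasis x xs) (n k : ℕ) :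
    xs n (x k) = if n = k then 1 else 0 := by
  split_ifs with h
  · rw [← h, hb.biorth_diag]
  · exact hb.biorth_off n k h

lemma IsBasis.coord_sum (hb : IsBasis x xs) (A : Finset ℕ) (a : ℕ → 𝕜) (n : ℕ) :
    xs n (∑ k ∈ A, a k • x k) = if n ∈ A then a n else 0 := by
  simp only [map_sum, map_smul, hb.coord_apply, smul_eq_mul, mul_ite, mul_one, mul_zero,
    Finset.sum_ite_eq]

/-- Uniform boundedness of all partial increasing relabellings with unimodular multipliers. -/
def PartialSpreadBound (x : ℕ → X) (xs : ℕ → X →L[𝕜] 𝕜) (K : ℝ) : Prop :=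
  ∀ {ι : Type} [LinearOrder ι] (F : Finset ι) (p q : ι → ℕ),
    StrictMonoOn p F → StrictMonoOn q F → ∀ lam : ι → 𝕜, (∀ i, ‖lam i‖ = 1) → ∀ f : X,
      ‖∑ i ∈ F, (lam i * xs (p i) f) • x (q i)‖ ≤ K * ‖f‖

lemma SubsymWith.norm_greedyProj_le {C : ℝ} (hC : 1 ≤ C) (hb : IsBasis x xs)
    (hss : SubsymWith 𝕜 (fun f : X => ‖f‖) x C) (A : Finset ℕ) (f : X) :
    ‖greedyProj x xs A f‖ ≤ C * ‖f‖ := by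
  obtain ⟨T, hT, hT1, -⟩ := hss (fun n => if n ∈ A then 1 else -1)
    (fun n => by split_ifs <;> simp) id strictMono_id
  have h : ContinuousLinearMap.id 𝕜 X + T = (2 : 𝕜) • ∑ n ∈ A, (xs n).smulRight (x n) := by
    refine hb.ext fun k => ?_
    simp only [add_apply, ContinuousLinearMap.id_apply, hT, id, smul_apply,
      sum_apply, ContinuousLinearMap.smulRight_apply, hb.coord_apply, ite_smul,
      one_smul, zero_smul, Finset.sum_ite_eq', neg_smul]
    split_ifs
    · rw [two_smul]
    · simp
  have h2 : f + T f = (2 : 𝕜) • greedyProj x xs A f := by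
    have := congrArg (fun S : X →L[𝕜] X => S f) h
    simpa [greedyProj] using this
  have h3 : ‖f + T f‖ = 2 * ‖greedyProj x xs A f‖ := by
    rw [h2, norm_smul]; simp
  have h4 := norm_add_le f (T f)
  have h5 := hT1 f
  have h6 : ‖f‖ ≤ C * ‖f‖ := le_mul_of_one_le_left (norm_nonneg f) hC
  dsimp only at h5
  linarith

lemma SubsymWith.partialSpreadBound {C : ℝ} (hC : 1 ≤ C) (hb : IsBasis x xs)
    (hss : SubsymWith 𝕜 (fun f : X => ‖f‖) x C) : PartialSpreadBound x xs (C ^ 3) := by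
  intro ι _ F p q hp hq lam hlam f
  rcases F.eq_empty_or_nonempty with rfl | ⟨i₀, hi₀⟩
  · simp only [Finset.sum_empty, norm_zero]; positivity
  have : Nonempty ι := ⟨i₀⟩
  obtain ⟨β, γ, hβ, hγ, hβγ⟩ := exists_strictMono_comp_eq F hp hq
  obtain ⟨T, hT, hT1, -⟩ := hss (fun n => lam (Function.invFunOn p F n)) (fun n => hlam _) β hβ
  obtain ⟨U, hU, -, hU2⟩ := hss (fun _ => 1) (fun n => by simp) γ hγ
  have hg : greedyProj x xs (F.image p) f = ∑ i ∈ F, xs (p i) f • x (p i) := by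
    rw [greedyProj, Finset.sum_image hp.injOn]
  have hTU : T (greedyProj x xs (F.image p) f)
      = U (∑ i ∈ F, (lam i * xs (p i) f) • x (q i)) := by
    rw [hg, map_sum, map_sum]
    refine Finset.sum_congr rfl fun i hi => ?_
    have : Function.invFunOn p F (p i) = i := hp.injOn.leftInvOn_invFunOn hi
    rw [map_smul, map_smul, hT, hU, hβγ i hi, this, smul_smul, one_smul, mul_comm]
  have h1 := hU2 (∑ i ∈ F, (lam i * xs (p i) f) • x (q i))
  have h2 := hT1 (greedyProj x xs (F.image p) f)
  have h3 := hss.norm_greedyProj_le hC hb (F.image p) f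
  dsimp only at h1 h2
  rw [← hTU] at h1
  have hC0 : 0 ≤ C := by linarith
  calc _ ≤ C * (C * (C * ‖f‖)) := h1.trans (mul_le_mul_of_nonneg_left
        (h2.trans (mul_le_mul_of_nonneg_left h3 hC0)) hC0)
    _ = C ^ 3 * ‖f‖ := by ring

variable {K : ℝ}

lemma PartialSpreadBound.norm_greedyProj_le (hK : PartialSpreadBound x xs K) (A : Finset ℕ)
    (f : X) : ‖greedyProj x xs A f‖ ≤ K * ‖f‖ := by
  have := hK A id id (strictMonoOn_id) (strictMonoOn_id) (fun _ => 1) (by simp) f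
  simpa [greedyProj] using this

lemma PartialSpreadBound.sum_functional_le (hK : PartialSpreadBound x xs K) {ι : Type}
    [LinearOrder ι] (F : Finset ι) {p q : ι → ℕ} (hp : StrictMonoOn p F) (hq : StrictMonoOn q F)
    {y : X →L[𝕜] 𝕜} (hy : ‖y‖ ≤ 1) (f : X) :
    ∑ i ∈ F, ‖y (x (q i))‖ * ‖xs (p i) f‖ ≤ K * ‖f‖ := by
  choose lam hlam hlam' using fun i : ι =>
    RCLike.exists_norm_eq_mul_self (xs (p i) f * y (x (q i)))
  have h1 : ((∑ i ∈ F, ‖y (x (q i))‖ * ‖xs (p i) f‖ : ℝ) : 𝕜)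
      = y (∑ i ∈ F, (lam i * xs (p i) f) • x (q i)) := by
    rw [map_sum, RCLike.ofReal_sum]
    refine Finset.sum_congr rfl fun i _ => ?_
    rw [map_smul, smul_eq_mul, mul_assoc, ← hlam' i, norm_mul, mul_comm]
  have h2 : 0 ≤ ∑ i ∈ F, ‖y (x (q i))‖ * ‖xs (p i) f‖ :=
    Finset.sum_nonneg fun i _ => by positivity
  calc _ = ‖((∑ i ∈ F, ‖y (x (q i))‖ * ‖xs (p i) f‖ : ℝ) : 𝕜)‖ := by
        rw [RCLike.norm_ofReal, abs_of_nonneg h2]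
    _ ≤ 1 * ‖∑ i ∈ F, (lam i * xs (p i) f) • x (q i)‖ := by
        rw [h1]; exact y.le_of_opNorm_le hy _
    _ ≤ K * ‖f‖ := by rw [one_mul]; exact hK F p q hp hq lam hlam f

lemma PartialSpreadBound.norm_sum_le (hK : PartialSpreadBound x xs K) (hb : IsBasis x xs)
    {A D : Finset ℕ} (hAD : A.card ≤ D.card) {ε : ℕ → 𝕜} (hε : ∀ n, ‖ε n‖ = 1) :
    ‖∑ n ∈ A, ε n • x n‖ ≤ K * ‖∑ n ∈ D, x n‖ := by
  obtain ⟨P, hPD, hcard⟩ := Finset.exists_subset_card_eq hAD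
  have h := hK (Finset.univ : Finset (Fin A.card)) (P.orderEmbOfFin hcard) (A.orderEmbOfFin rfl)
    ((P.orderEmbOfFin hcard).strictMono.strictMonoOn _)
    ((A.orderEmbOfFin rfl).strictMono.strictMonoOn _)
    (fun i => ε (A.orderEmbOfFin rfl i)) (fun _ => hε _) (∑ n ∈ D, x n)
  have h1 : ∀ i, xs (P.orderEmbOfFin hcard i) (∑ n ∈ D, x n) = 1 := fun i => by
    have := hb.coord_sum D (fun _ => 1) (P.orderEmbOfFin hcard i)
    simp only [one_smul] at this
    rw [this, if_pos (hPD (Finset.orderEmbOfFin_mem P hcard i))]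
  simp only [h1, mul_one] at h
  convert h using 2
  conv_lhs => rw [← Finset.image_orderEmbOfFin_univ A rfl]
  rw [Finset.sum_image (A.orderEmbOfFin rfl).injective.injOn]

lemma PartialSpreadBound.sum_mul_norm_le (hK : PartialSpreadBound x xs K) {A : Finset ℕ}
    (hA : A.Nonempty) (f : X) :
    (∑ n ∈ A, ‖xs n f‖) * ‖∑ n ∈ Finset.range A.card, x n‖ ≤ 2 * K * A.card * ‖f‖ := by
  obtain ⟨k, hk⟩ : ∃ k, A.card = k := ⟨_, rfl⟩
  have : NeZero k := ⟨by have := hA.card_pos; omega⟩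
  set p := A.orderEmbOfFin hk with hp
  choose lam hlam hlam' using fun i : Fin k => RCLike.exists_norm_eq_mul_self (xs (p i) f)
  have hpm : ∀ s : Set (Fin k), StrictMonoOn p s := fun s => p.strictMono.strictMonoOn s
  have hshift : ∀ s : Fin k, ‖∑ i : Fin k, (lam i * xs (p i) f) • x (i + s : Fin k)‖
      ≤ 2 * K * ‖f‖ := by
    intro s
    have hval : ∀ i : Fin k, ((i + s : Fin k) : ℕ)
        = if i.val + s.val < k then i.val + s.val else i.val + s.val - k := by
      intro i
      have h1 := i.isLt
      have h2 := s.isLt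
      rw [Fin.val_add]
      split_ifs with h
      · exact Nat.mod_eq_of_lt h
      · rw [Nat.mod_eq_sub_mod (by omega)]
        exact Nat.mod_eq_of_lt (by omega)
    rw [← Finset.sum_filter_add_sum_filter_not Finset.univ (fun i : Fin k => i.val + s.val < k)]
    refine (norm_add_le _ _).trans ?_
    have b1 := hK (Finset.univ.filter fun i : Fin k => i.val + s.val < k) p
      (fun i => ((i + s : Fin k) : ℕ)) (hpm _) (by
        intro i hi j hj hij
        simp only [Finset.coe_filter, Finset.mem_univ, true_and, Set.mem_ofPred_eq] at hi hj
        have : i.val < j.val := hij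
        simp only [hval, hi, hj, if_true]
        omega) lam hlam f
    have b2 := hK (Finset.univ.filter fun i : Fin k => ¬ i.val + s.val < k) p
      (fun i => ((i + s : Fin k) : ℕ)) (hpm _) (by
        intro i hi j hj hij
        simp only [Finset.coe_filter, Finset.mem_univ, true_and, Set.mem_ofPred_eq] at hi hj
        have : i.val < j.val := hij
        simp only [hval, hi, hj, if_false]
        omega) lam hlam f
    linarith
  have hA' : ∑ n ∈ A, ‖xs n f‖ = ∑ i : Fin k, ‖xs (p i) f‖ := by
    conv_lhs => rw [← Finset.image_orderEmbOfFin_univ A hk]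
    rw [Finset.sum_image p.injective.injOn]
  have htot : ∑ s : Fin k, ∑ i : Fin k, (lam i * xs (p i) f) • x (i + s : Fin k)
      = ((∑ n ∈ A, ‖xs n f‖ : ℝ) : 𝕜) • ∑ n ∈ Finset.range k, x n := by
    rw [Finset.sum_comm, hA', RCLike.ofReal_sum, Finset.sum_smul]
    refine Finset.sum_congr rfl fun i _ => ?_
    have hrot : ∑ s : Fin k, x (i + s : Fin k) = ∑ j : Fin k, x j :=
      Equiv.sum_comp (Equiv.addLeft i) (fun j : Fin k => x j)
    rw [← Finset.smul_sum, hrot, hlam' i, Finset.sum_range]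
  have hn : 0 ≤ ∑ n ∈ A, ‖xs n f‖ := Finset.sum_nonneg fun n _ => norm_nonneg _
  calc _ = ‖((∑ n ∈ A, ‖xs n f‖ : ℝ) : 𝕜) • ∑ n ∈ Finset.range k, x n‖ := by
        rw [norm_smul, RCLike.norm_ofReal, abs_of_nonneg hn, hk]
    _ ≤ ∑ s : Fin k, 2 * K * ‖f‖ := by
        rw [← htot]; exact (_root_.norm_sum_le _ _).trans (Finset.sum_le_sum fun s _ => hshift s)
    _ = 2 * K * A.card * ‖f‖ := by
        rw [Finset.sum_const, Finset.card_univ, Fintype.card_fin, nsmul_eq_mul, hk]; ring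

/-! ### The fundamental function of a subsymmetric basis -/

lemma PartialSpreadBound.le_fundFun (hK : PartialSpreadBound x xs K) (hb : IsBasis x xs)
    {A : Finset ℕ} {m : ℕ} (hA : A.card ≤ m) {ε : ℕ → 𝕜} (hε : ∀ n, ‖ε n‖ = 1) :
    ‖∑ n ∈ A, ε n • x n‖ ≤ fundFun 𝕜 x m := by
  refine le_csSup ⟨K * ‖∑ n ∈ Finset.range m, x n‖, ?_⟩ ⟨A, ε, hA, hε, rfl⟩
  rintro r ⟨B, δ, hB, hδ, rfl⟩
  exact hK.norm_sum_le hb (by simpa using hB) hδ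

lemma PartialSpreadBound.fundFun_le (hK : PartialSpreadBound x xs K) (hb : IsBasis x xs)
    (D : Finset ℕ) : fundFun 𝕜 x D.card ≤ K * ‖∑ n ∈ D, x n‖ := by
  refine csSup_le ⟨_, ∅, fun _ => 1, by simp, by simp, rfl⟩ ?_
  rintro r ⟨B, δ, hB, hδ, rfl⟩
  exact hK.norm_sum_le hb hB hδ

lemma fundFun_le_of_forall {m : ℕ} {r : ℝ}
    (h : ∀ (A : Finset ℕ) (ε : ℕ → 𝕜), A.card ≤ m → (∀ n, ‖ε n‖ = 1) →
      ‖∑ n ∈ A, ε n • x n‖ ≤ r) : fundFun 𝕜 x m ≤ r := by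
  refine csSup_le ⟨_, ∅, fun _ => 1, by simp, by simp, rfl⟩ ?_
  rintro r ⟨B, δ, hB, hδ, rfl⟩
  exact h B δ hB hδ

lemma PartialSpreadBound.fundFun_mono (hK : PartialSpreadBound x xs K) (hb : IsBasis x xs) :
    Monotone (fundFun 𝕜 x) := fun _ _ hmn =>
  fundFun_le_of_forall fun _ _ hA hε => hK.le_fundFun hb (hA.trans hmn) hε

lemma PartialSpreadBound.fundFun_pos (hK : PartialSpreadBound x xs K) (hb : IsBasis x xs)
    {m : ℕ} (hm : 1 ≤ m) : 0 < fundFun 𝕜 x m := by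
  have h := hK.le_fundFun hb (A := {0}) (by simpa using hm) (ε := fun _ => 1) (by simp)
  obtain ⟨c, hc, hcx⟩ := hb.norm_pos
  simp only [one_smul, Finset.sum_singleton] at h
  exact hc.trans_le ((hcx 0).trans h)

lemma PartialSpreadBound.fundFun_add_le (hK : PartialSpreadBound x xs K) (hb : IsBasis x xs)
    (m n : ℕ) : fundFun 𝕜 x (m + n) ≤ fundFun 𝕜 x m + fundFun 𝕜 x n := by
  refine fundFun_le_of_forall fun A ε hA hε => ?_
  obtain ⟨P, hPA, hP⟩ := Finset.exists_subset_card_eq (min_le_left A.card m)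
  have hc := Finset.card_sdiff_add_card_eq_card hPA
  rw [← Finset.sum_sdiff hPA, add_comm]
  exact (norm_add_le _ _).trans (add_le_add (hK.le_fundFun hb (by omega) hε)
    (hK.le_fundFun hb (by omega) hε))

lemma PartialSpreadBound.fundFun_mul_le (hK : PartialSpreadBound x xs K) (hb : IsBasis x xs)
    (a m : ℕ) : fundFun 𝕜 x (a * m) ≤ a * fundFun 𝕜 x m := by
  induction a with
  | zero =>
    simp only [zero_mul, Nat.cast_zero]
    refine fundFun_le_of_forall fun A ε hA _ => ?_
    simp [Finset.card_eq_zero.1 (Nat.le_zero.1 hA)]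
  | succ a ih =>
    rw [add_mul, one_mul]
    refine (hK.fundFun_add_le hb _ _).trans ?_
    push_cast
    linarith

lemma PartialSpreadBound.fundFun_div_le (hK : PartialSpreadBound x xs K) (hb : IsBasis x xs)
    {j n : ℕ} (hj : 1 ≤ j) (hjn : j ≤ n) :
    fundFun 𝕜 x n / n ≤ 2 * (fundFun 𝕜 x j / j) := by
  have h1 : n ≤ (n / j + 1) * j := by
    have := Nat.lt_div_mul_add (a := n) (b := j) (by omega)
    rw [add_mul, one_mul]; omega
  have h2 := (hK.fundFun_mono hb h1).trans (hK.fundFun_mul_le hb _ _)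
  have hj0 : (0 : ℝ) < j := by exact_mod_cast hj
  have hn0 : (0 : ℝ) < n := by exact_mod_cast (hj.trans hjn)
  have h3 : ((n / j + 1 : ℕ) : ℝ) ≤ 2 * (n / j) := by
    have a1 : ((n / j : ℕ) : ℝ) ≤ n / j := Nat.cast_div_le
    have a2 : (1 : ℝ) ≤ n / j := by rw [one_le_div hj0]; exact_mod_cast hjn
    push_cast; linarith
  have hpos := hK.fundFun_pos hb hj
  rw [div_le_iff₀ hn0]
  calc fundFun 𝕜 x n ≤ _ := h2
    _ ≤ 2 * (n / j) * fundFun 𝕜 x j := mul_le_mul_of_nonneg_right h3 hpos.le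
    _ = _ := by field_simp

lemma PartialSpreadBound.pos (hK : PartialSpreadBound x xs K) (hb : IsBasis x xs) : 0 < K := by
  have h1 := hK.fundFun_le hb {0}
  have h2 := hK.fundFun_pos hb (m := 1) le_rfl
  rw [Finset.card_singleton] at h1
  exact pos_of_mul_pos_left (h2.trans_le h1) (norm_nonneg _)

lemma PartialSpreadBound.hasLRP (hK : PartialSpreadBound x xs K) (hb : IsBasis x xs)
    (hcot : NontrivialCotype X) : HasLRP (fundFun 𝕜 x) := by
  obtain ⟨q, C, hq, hC, hcot⟩ := hcot
  have hK0 := hK.pos hb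
  obtain ⟨r, hr⟩ := exists_nat_ge ((2 * K * C) ^ q)
  have hr0 : 0 < r := by
    have : (0 : ℝ) < (2 * K * C) ^ q := by positivity
    exact_mod_cast this.trans_le hr
  refine ⟨r, hr0, fun m hm => ?_⟩
  set D : Fin r → Finset ℕ := fun i => Finset.Ico (i * m) (i * m + m) with hD
  have hdiv : ∀ i, ∀ n ∈ D i, n / m = i := by
    intro i n hn
    rw [hD, Finset.mem_Ico] at hn
    exact Nat.div_eq_of_lt_le hn.1 (by rw [Nat.succ_mul]; exact hn.2)
  have hdisj : ∀ i j : Fin r, i ≠ j → Disjoint (D i) (D j) := by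
    intro i j hij
    refine Finset.disjoint_left.2 fun n hi hj => hij (Fin.ext ?_)
    rw [← hdiv i n hi, hdiv j n hj]
  have hcard : ∀ i, (D i).card = m := fun i => by simp [hD]
  have hφ := hK.fundFun_pos hb hm
  have h := hcot r (fun i => ∑ n ∈ D i, x n)
  have hub : ∀ ε : Fin r → Bool,
      ‖∑ i, (if ε i then ∑ n ∈ D i, x n else -∑ n ∈ D i, x n)‖ ≤ fundFun 𝕜 x (r * m) := by
    intro ε
    set δ : ℕ → 𝕜 := fun n => if h : n / m < r then (if ε ⟨n / m, h⟩ then 1 else -1) else 1 with hδ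
    have hδ1 : ∀ n, ‖δ n‖ = 1 := fun n => by simp only [hδ]; split_ifs <;> simp
    have hA : (Finset.univ.biUnion D).card ≤ r * m := by
      refine Finset.card_biUnion_le.trans ?_
      simp [hcard]
    have := hK.le_fundFun hb hA hδ1
    rw [Finset.sum_biUnion (fun i _ j _ hij => hdisj i j hij)] at this
    convert this using 3 with i _
    have hin : ∀ n ∈ D i, δ n = if ε i then 1 else -1 := fun n hn => by
      have h1 := hdiv i n hn
      simp only [hδ, h1, i.isLt, dif_pos]
    rw [Finset.sum_congr rfl fun n hn => congrArg (· • x n) (hin n hn)]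
    split_ifs <;> simp
  have hav : ((2 : ℝ) ^ r)⁻¹ * ∑ ε : Fin r → Bool,
      ‖∑ i, (if ε i then ∑ n ∈ D i, x n else -∑ n ∈ D i, x n)‖ ≤ fundFun 𝕜 x (r * m) := by
    have := Finset.sum_le_sum fun (ε : Fin r → Bool) (_ : ε ∈ Finset.univ) => hub ε
    rw [Finset.sum_const, Finset.card_univ, Fintype.card_fun, Fintype.card_bool, Fintype.card_fin,
      nsmul_eq_mul] at this
    rw [inv_mul_le_iff₀ (by positivity)]
    exact_mod_cast this
  have hlow : (r : ℝ) ^ (1 / q) * (fundFun 𝕜 x m / K)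
      ≤ (∑ i : Fin r, ‖∑ n ∈ D i, x n‖ ^ q) ^ (1 / q) := by
    have h1 : (r : ℝ) * (fundFun 𝕜 x m / K) ^ q ≤ ∑ i : Fin r, ‖∑ n ∈ D i, x n‖ ^ q := by
      have : ∑ _i : Fin r, (fundFun 𝕜 x m / K) ^ q = (r : ℝ) * (fundFun 𝕜 x m / K) ^ q := by simp
      rw [← this]
      refine Finset.sum_le_sum fun i _ => Real.rpow_le_rpow (by positivity) ?_ hq.le
      rw [div_le_iff₀ hK0, mul_comm]
      have := hK.fundFun_le hb (D i)
      rwa [hcard] at this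
    refine le_trans (le_of_eq ?_) (Real.rpow_le_rpow (by positivity) h1 (by positivity))
    rw [Real.mul_rpow (by positivity) (by positivity), ← Real.rpow_mul (by positivity),
      mul_one_div_cancel hq.ne', Real.rpow_one]
  have hr' : 2 * K * C ≤ (r : ℝ) ^ (1 / q) := by
    have := Real.rpow_le_rpow (by positivity) hr (show 0 ≤ 1 / q by positivity)
    rwa [← Real.rpow_mul (by positivity), mul_one_div_cancel hq.ne', Real.rpow_one] at this
  have h1 : 2 * K * C * (fundFun 𝕜 x m / K) ≤ C * fundFun 𝕜 x (r * m) :=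
    (mul_le_mul_of_nonneg_right hr' (by positivity)).trans
      (hlow.trans (h.trans (mul_le_mul_of_nonneg_left hav hC.le)))
  have h2 : 2 * K * C * (fundFun 𝕜 x m / K) = C * (2 * fundFun 𝕜 x m) := by field_simp
  rw [h2] at h1
  exact le_of_mul_le_mul_left h1 hC

end Subsymmetric

/-! ### Existence of Dini regularizations -/

/-- The running infimum of `j ↦ τ j / j` over `1 ≤ j ≤ m`. -/
def runningInf (τ : ℕ → ℝ) : ℕ → ℝ
  | 0 => τ 1
  | m + 1 => min (runningInf τ m) (τ (m + 1) / (m + 1 : ℕ))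

lemma runningInf_antitone (τ : ℕ → ℝ) : Antitone (runningInf τ) :=
  antitone_nat_of_succ_le fun _ => min_le_left _ _

lemma runningInf_le (τ : ℕ → ℝ) {m : ℕ} (hm : 1 ≤ m) : runningInf τ m ≤ τ m / m := by
  obtain ⟨m, rfl⟩ := Nat.exists_eq_add_of_le' hm
  exact min_le_right _ _

lemma le_runningInf {τ : ℕ → ℝ} {a : ℝ} {m n : ℕ} (hn : 1 ≤ n) (hmn : m ≤ n)
    (h : ∀ j, 1 ≤ j → j ≤ n → a ≤ τ j / j) : a ≤ runningInf τ m := by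
  induction m with
  | zero => simpa [runningInf] using h 1 le_rfl hn
  | succ m ih => exact le_min (ih (by omega)) (h (m + 1) (by omega) hmn)

lemma HasLRP.sum_div_le {τ : ℕ → ℝ} (hpos : ∀ m, 1 ≤ m → 0 < τ m) (hmono : Monotone τ)
    (hlrp : HasLRP τ) :
    ∃ L : ℝ, 1 ≤ L ∧ ∀ m : ℕ, 1 ≤ m →
      ∑ j ∈ Finset.range m, τ (j + 1) / (j + 1 : ℕ) ≤ L * τ m := by
  obtain ⟨r, hr, hlrp⟩ := hlrp
  have hr2 : 2 ≤ r := by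
    by_contra hlt
    obtain rfl : r = 1 := by omega
    have h1 := hlrp 1 le_rfl
    have h2 := hpos 1 le_rfl
    rw [one_mul] at h1
    linarith
  have hr1 : (1 : ℝ) ≤ r := by exact_mod_cast hr
  refine ⟨2 * r, by linarith, fun m => ?_⟩
  induction m using Nat.strong_induction_on with
  | _ m ih =>
    intro hm
    have hlt : m / r < m := Nat.div_lt_self (by omega) hr2
    have hm0 : (0 : ℝ) < m := by exact_mod_cast hm
    have hτ := hpos m hm
    rw [← Finset.sum_range_add_sum_Ico _ hlt.le]
    have h1 : ∑ j ∈ Finset.range (m / r), τ (j + 1) / (j + 1 : ℕ) ≤ r * τ m := by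
      rcases Nat.eq_zero_or_pos (m / r) with h0 | h0
      · rw [h0]; simp only [Finset.range_zero, Finset.sum_empty]; positivity
      · refine (ih _ hlt h0).trans ?_
        have h2 := (hlrp _ h0).trans (hmono (Nat.mul_div_le m r))
        have := mul_le_mul_of_nonneg_left h2 (show (0 : ℝ) ≤ r by linarith)
        linarith
    have h2 : ∑ j ∈ Finset.Ico (m / r) m, τ (j + 1) / (j + 1 : ℕ) ≤ r * τ m := by
      have hterm : ∀ j ∈ Finset.Ico (m / r) m, τ (j + 1) / (j + 1 : ℕ) ≤ r * τ m / m := by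
        intro j hj
        rw [Finset.mem_Ico] at hj
        have h3 : m < (j + 1) * r := (Nat.div_lt_iff_lt_mul (by omega)).1 (by omega)
        have h4 : (m : ℝ) ≤ (j + 1 : ℕ) * r := by exact_mod_cast h3.le
        rw [div_le_div_iff₀ (by positivity) hm0]
        calc τ (j + 1) * m ≤ τ m * ((j + 1 : ℕ) * r) :=
              mul_le_mul (hmono (by omega)) h4 hm0.le hτ.le
          _ = _ := by ring
      refine (Finset.sum_le_sum hterm).trans ?_
      rw [Finset.sum_const, nsmul_eq_mul, Nat.card_Ico]
      have h5 : ((m - m / r : ℕ) : ℝ) ≤ m := by exact_mod_cast Nat.sub_le _ _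
      calc ((m - m / r : ℕ) : ℝ) * (r * τ m / m) ≤ m * (r * τ m / m) :=
            mul_le_mul_of_nonneg_right h5 (by positivity)
        _ = r * τ m := by field_simp
    linarith

lemma exists_goodDiniReg {τ : ℕ → ℝ} (hpos : ∀ m, 1 ≤ m → 0 < τ m) (hmono : Monotone τ)
    (hdiv : ∀ j n : ℕ, 1 ≤ j → j ≤ n → τ n / n ≤ 2 * (τ j / j)) (hlrp : HasLRP τ) :
    ∃ σ : ℕ → ℝ, GoodDiniReg σ τ := by
  obtain ⟨L, hL, hsum⟩ := hlrp.sum_div_le hpos hmono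
  set w := runningInf τ with hw
  have hanti : Antitone w := runningInf_antitone τ
  set σ : ℕ → ℝ := fun m => ∑ j ∈ Finset.range m, w (j + 1) with hσ
  have hwlow : ∀ m, 1 ≤ m → τ m / m ≤ 2 * w m := fun m hm => by
    have : τ m / m / 2 ≤ w m := le_runningInf hm le_rfl fun j hj hjm => by
      have := hdiv j m hj hjm
      linarith
    linarith
  have hwpos : ∀ m, 1 ≤ m → 0 < w m := fun m hm => by
    have h1 := hwlow m hm
    have h2 : 0 < τ m / m := div_pos (hpos m hm) (by exact_mod_cast hm)
    linarith
  have hsucc : ∀ m, σ (m + 1) = σ m + w (m + 1) := fun m => Finset.sum_range_succ _ _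
  have hσlow : ∀ m : ℕ, (m : ℝ) * w m ≤ σ m := fun m => by
    have : ∑ j ∈ Finset.range m, w m ≤ σ m :=
      Finset.sum_le_sum fun j hj => hanti (by rw [Finset.mem_range] at hj; omega)
    simpa using this
  have hσup : ∀ m, 1 ≤ m → σ m ≤ L * τ m := fun m hm =>
    (Finset.sum_le_sum fun j _ => runningInf_le τ (by omega)).trans (hsum m hm)
  have hτw : ∀ m, 1 ≤ m → τ m ≤ 2 * (m * w m) := fun m hm => by
    have h1 := hwlow m hm
    rw [div_le_iff₀ (by exact_mod_cast hm)] at h1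
    linarith
  have hσpos : ∀ m, 1 ≤ m → 0 < σ m := fun m hm =>
    (mul_pos (by exact_mod_cast hm) (hwpos m hm)).trans_le (hσlow m)
  refine ⟨σ, ⟨by simp [hσ], ⟨2 * L, by linarith, fun m hm => ?_⟩, ⟨2 * L, by linarith,
    fun m hm => ⟨?_, ?_⟩⟩⟩, hσpos, fun m _ => ?_, fun m hm => ?_⟩
  · have hm0 : (0 : ℝ) < m := by exact_mod_cast hm
    have hdiff : σ m - σ (m - 1) = w m := by
      obtain ⟨n, rfl⟩ := Nat.exists_eq_add_of_le' hm
      rw [hsucc, Nat.add_sub_cancel]; ring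
    have h1 := hσup m hm
    have h2 := mul_le_mul_of_nonneg_left (hτw m hm) (show 0 ≤ L by linarith)
    rw [hdiff]
    constructor
    · rw [one_div, ← div_eq_inv_mul, div_le_iff₀ (by linarith), div_le_iff₀ hm0]
      linarith
    · have h3 : w m ≤ σ m / m := by rw [le_div_iff₀ hm0]; linarith [hσlow m]
      have h4 : 0 ≤ σ m / m := (hwpos m hm).le.trans h3
      exact h3.trans (le_mul_of_one_le_left h4 (by linarith))
  · have h1 := hτw m hm
    have h2 := hσlow m
    have h3 : 2 * σ m ≤ 2 * L * σ m :=
      mul_le_mul_of_nonneg_right (by linarith) (hσpos m hm).le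
    rw [one_div, ← div_eq_inv_mul, div_le_iff₀ (by linarith)]
    linarith
  · have h1 := hσup m hm
    have h2 := mul_pos (show 0 < L by linarith) (hpos m hm)
    linarith
  · rw [hsucc]
    linarith [hwpos (m + 1) (by omega)]
  · rw [div_le_div_iff₀ (hσpos m hm) (hσpos (m + 1) (by omega)), hsucc]
    have h1 : (m : ℝ) * w (m + 1) ≤ m * w m :=
      mul_le_mul_of_nonneg_left (hanti (Nat.le_succ m)) (Nat.cast_nonneg m)
    have h2 := hσlow m
    linarith

/-! ### The renorming -/

section Renorming

variable {𝕜 : Type*} [RCLike 𝕜] {X : Type*} [NormedAddCommGroup X] [NormedSpace 𝕜 X]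
  {x : ℕ → X} {xs : ℕ → X →L[𝕜] 𝕜} {σ : ℕ → ℝ} {η : ℝ} {S : Set (ℕ → ℝ)}

/-- The supremum of all admissible testing functionals at the coordinates of `f`. -/
def testerNorm (σ : ℕ → ℝ) (η : ℝ) (S : Set (ℕ → ℝ)) (xs : ℕ → X →L[𝕜] 𝕜) (f : X) : ℝ :=
  ⨆ g : {g : Tester // g.Admissible σ η S}, g.1.val σ (fun n => ‖xs n f‖)

/-- Admissible testing functionals are uniformly bounded. -/
def TesterBound (σ : ℕ → ℝ) (η : ℝ) (S : Set (ℕ → ℝ)) (xs : ℕ → X →L[𝕜] 𝕜) (M : ℝ) : Prop :=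
  ∀ (f : X) (g : Tester), g.Admissible σ η S → g.val σ (fun n => ‖xs n f‖) ≤ M * ‖f‖

namespace Compatible

lemma testerNorm_nonneg (h : Compatible σ η S) (f : X) : 0 ≤ testerNorm σ η S xs f :=
  Real.iSup_nonneg fun g => h.val_nonneg g.2 fun _ => norm_nonneg _

end Compatible

namespace TesterBound

variable {M : ℝ}

lemma le_testerNorm (hM : TesterBound σ η S xs M) (f : X) {g : Tester}
    (hg : g.Admissible σ η S) : g.val σ (fun n => ‖xs n f‖) ≤ testerNorm σ η S xs f :=
  le_ciSup (f := fun g : {g : Tester // g.Admissible σ η S} => g.1.val σ (fun n => ‖xs n f‖))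
    ⟨M * ‖f‖, by rintro _ ⟨g, rfl⟩; exact hM f g.1 g.2⟩ ⟨g, hg⟩

lemma testerNorm_le_testerNorm (hM : TesterBound σ η S xs M) (h : Compatible σ η S) {f f' : X}
    (hff' : ∀ g : Tester, g.Admissible σ η S → ∃ g' : Tester, g'.Admissible σ η S ∧
      g.val σ (fun n => ‖xs n f‖) ≤ g'.val σ (fun n => ‖xs n f'‖)) :
    testerNorm σ η S xs f ≤ testerNorm σ η S xs f' := by
  refine Real.iSup_le (fun g => ?_) (h.testerNorm_nonneg f')
  obtain ⟨g', hg', hle⟩ := hff' g.1 g.2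
  exact hle.trans (hM.le_testerNorm f' hg')

lemma testerNorm_add_le (hM : TesterBound σ η S xs M) (h : Compatible σ η S) (f f' : X) :
    testerNorm σ η S xs (f + f') ≤ testerNorm σ η S xs f + testerNorm σ η S xs f' := by
  refine Real.iSup_le (fun g => ?_) (add_nonneg (h.testerNorm_nonneg f) (h.testerNorm_nonneg f'))
  refine le_trans ?_ (add_le_add (hM.le_testerNorm f g.2) (hM.le_testerNorm f' g.2))
  refine (h.val_mono g.2 (v := fun n => ‖xs n f‖ + ‖xs n f'‖) fun n => ?_).trans (le_of_eq ?_)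
  · rw [map_add]; exact norm_add_le _ _
  · simp only [Tester.val, mul_add, Finset.sum_add_distrib]; ring

lemma testerNorm_sum_smul (hM : TesterBound σ η S xs M) (h : Compatible σ η S)
    (h0 : (fun _ => 0) ∈ S) (hb : IsBasis x xs) {A : Finset ℕ} (hA : A.Nonempty) {ε : ℕ → 𝕜}
    (hε : ∀ n, ‖ε n‖ = 1) : testerNorm σ η S xs (∑ n ∈ A, ε n • x n) = σ A.card := by
  have hcoord : (fun n => ‖xs n (∑ n ∈ A, ε n • x n)‖) = fun n => if n ∈ A then 1 else 0 := by
    funext n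
    rw [hb.coord_sum]
    split_ifs <;> simp [hε]
  have hσ := h.pos A.card hA.card_pos
  refine le_antisymm (Real.iSup_le (fun g => ?_) hσ.le) ?_
  · rw [hcoord]; exact h.val_indicator_le hA g.2
  · have hc : (A.card : ℝ) ≠ 0 := by exact_mod_cast hA.card_pos.ne'
    have := hM.le_testerNorm (∑ n ∈ A, ε n • x n) (g := ⟨A.card, A, ∅, fun _ => 0⟩)
      ⟨hA.card_pos, le_rfl, h0, fun _ =>
        mul_nonneg h.eta_pos.le (h.div_nonneg hA.card_pos)⟩
    rw [hcoord] at this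
    refine le_trans (le_of_eq ?_) this
    simp only [Tester.val, Finset.sum_ite_mem, Finset.inter_self]
    simp only [Finset.sum_const, Finset.empty_sdiff, Finset.sum_empty, nsmul_eq_mul]
    field_simp
    ring

lemma greedyWith (hM : TesterBound σ η S xs M) (h : Compatible σ η S) (hb : IsBasis x xs) :
    GreedyWith (testerNorm σ η S xs) x xs 1 := by
  intro f A B a hA hBA
  rw [one_mul]
  rcases A.eq_empty_or_nonempty with rfl | hne
  · have : B = ∅ := Finset.card_eq_zero.1 (Nat.le_zero.1 hBA)
    simp [this, greedyProj]
  obtain ⟨n₀, hn₀, hmin⟩ := Finset.exists_min_image A (fun n => ‖xs n f‖) hne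
  have hu : ∀ n, ‖xs n (f - greedyProj x xs A f)‖ = if n ∈ A then 0 else ‖xs n f‖ := fun n => by
    rw [map_sub, greedyProj, hb.coord_sum A (fun n => xs n f)]
    split_ifs <;> simp
  have hv : ∀ n, n ∉ B → ‖xs n (f - ∑ k ∈ B, a k • x k)‖ = ‖xs n f‖ := fun n hn => by
    rw [map_sub, hb.coord_sum, if_neg hn, sub_zero]
  refine hM.testerNorm_le_testerNorm h fun g hg => h.exists_exchange (t := ‖xs n₀ f‖)
    (P := B \ A) (Q := A \ B) (fun _ => norm_nonneg _) (fun n => ?_) (fun _ => norm_nonneg _)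
    (Finset.card_sdiff_le_card_sdiff_iff.2 hBA)
    (Finset.disjoint_left.2 fun n hn hn' => (Finset.mem_sdiff.1 hn).2 (Finset.mem_sdiff.1 hn').1)
    (fun n hn => ?_) (fun n hn => ?_) (fun n hP hQ => ?_) hg
  · rw [hu]
    split_ifs with hn
    · exact norm_nonneg _
    · exact hA n₀ hn₀ n hn
  · rw [hu, if_pos (Finset.mem_sdiff.1 hn).1]
  · rw [hv n (Finset.mem_sdiff.1 hn).2]
    exact hmin n (Finset.mem_sdiff.1 hn).1
  · rw [hu]
    split_ifs with hn
    · exact norm_nonneg _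
    · rw [hv n fun hnB => hP (Finset.mem_sdiff.2 ⟨hnB, hn⟩)]

lemma bidemocraticWith (hM : TesterBound σ η S xs M) (h : Compatible σ η S)
    (h0 : (fun _ => 0) ∈ S) (hb : IsBasis x xs) :
    BidemocraticWith (testerNorm σ η S xs) x xs 1 := by
  intro A B ε δ hε hδ
  rw [one_mul]
  rcases A.eq_empty_or_nonempty with rfl | hA
  · have : testerNorm σ η S xs (0 : X) = 0 := by simp [testerNorm, Tester.val]
    simp [this]
  have hσA := h.pos _ hA.card_pos
  rw [hM.testerNorm_sum_smul h h0 hb hA hε]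
  rcases B.eq_empty_or_nonempty with rfl | hB
  · have : dualNormWith (testerNorm σ η S xs) (∑ n ∈ (∅ : Finset ℕ), δ n • xs n) ≤ 0 := by
      refine Real.sSup_le ?_ le_rfl
      rintro r ⟨f, -, rfl⟩
      simp
    exact (mul_nonpos_of_nonneg_of_nonpos hσA.le this).trans (Nat.cast_nonneg _)
  have hσB := h.pos _ hB.card_pos
  have hB0 : (0 : ℝ) < B.card := by exact_mod_cast hB.card_pos
  have hdual : dualNormWith (testerNorm σ η S xs) (∑ n ∈ B, δ n • xs n) ≤ B.card / σ B.card := by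
    refine Real.sSup_le ?_ (by positivity)
    rintro r ⟨f, hf, rfl⟩
    have h1 := (hM.le_testerNorm f (g := ⟨B.card, B, ∅, fun _ => 0⟩)
      ⟨hB.card_pos, le_rfl, h0, fun _ =>
        mul_nonneg h.eta_pos.le (h.div_nonneg hB.card_pos)⟩).trans hf
    simp only [Tester.val, Finset.empty_sdiff, Finset.sum_empty, add_zero] at h1
    have h2 : ‖(∑ n ∈ B, δ n • xs n) f‖ ≤ ∑ n ∈ B, ‖xs n f‖ := by
      rw [sum_apply]
      refine (norm_sum_le _ _).trans (Finset.sum_le_sum fun n _ => ?_)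
      rw [smul_apply, norm_smul, hδ, one_mul]
    rw [div_mul_eq_mul_div, div_le_iff₀ hB0, one_mul] at h1
    rw [le_div_iff₀ hσB]
    calc _ ≤ (∑ n ∈ B, ‖xs n f‖) * σ B.card := mul_le_mul_of_nonneg_right h2 hσB.le
      _ ≤ B.card := by linarith
  refine (mul_le_mul_of_nonneg_left hdual hσA.le).trans ?_
  rcases le_total A.card B.card with hAB | hAB
  · rw [max_eq_right hAB, ← mul_div_assoc, div_le_iff₀ hσB, mul_comm]
    exact mul_le_mul_of_nonneg_left (h.monotone hA.card_pos hAB) hB0.le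
  · rw [max_eq_left hAB, ← mul_div_assoc, div_le_iff₀ hσB]
    have hA0 : (0 : ℝ) < A.card := by exact_mod_cast hA.card_pos
    have := h.antitone_div hB.card_pos hAB
    rw [div_le_div_iff₀ hA0 hB0] at this
    linarith

lemma fundFunWith_eq (hM : TesterBound σ η S xs M) (h : Compatible σ η S)
    (h0 : (fun _ => 0) ∈ S) (hb : IsBasis x xs) {m : ℕ} (hm : 1 ≤ m) :
    fundFunWith 𝕜 (testerNorm σ η S xs) x m = σ m := by
  have hub : σ m ∈ upperBounds {r : ℝ | ∃ (A : Finset ℕ) (ε : ℕ → 𝕜), A.card ≤ m ∧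
      (∀ n, ‖ε n‖ = 1) ∧ r = testerNorm σ η S xs (∑ n ∈ A, ε n • x n)} := by
    rintro r ⟨A, ε, hA, hε, rfl⟩
    rcases A.eq_empty_or_nonempty with rfl | hne
    · have : testerNorm σ η S xs (0 : X) = 0 := by simp [testerNorm, Tester.val]
      simpa [this] using (h.pos m hm).le
    · rw [hM.testerNorm_sum_smul h h0 hb hne hε]
      exact h.monotone hne.card_pos hA
  refine IsLUB.csSup_eq ⟨hub, fun r hr => hr ⟨Finset.range m, fun _ => 1, by simp, by simp, ?_⟩⟩
    ⟨_, ∅, fun _ => 1, by simp, by simp, rfl⟩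
  rw [hM.testerNorm_sum_smul h h0 hb (by simpa using (by omega : m ≠ 0)) (by simp),
    Finset.card_range]

lemma subsymWith (hM : TesterBound σ η S xs M) (h : Compatible σ η S)
    (hpull : ∀ b ∈ S, ∀ β : ℕ → ℕ, StrictMono β → (fun n => b (β n)) ∈ S)
    (hpush : ∀ b ∈ S, ∀ β : ℕ → ℕ, StrictMono β → Function.extend β b 0 ∈ S)
    (hb : IsBasis x xs) {C : ℝ} (hss : SubsymWith 𝕜 (fun f : X => ‖f‖) x C) :
    SubsymWith 𝕜 (testerNorm σ η S xs) x 1 := by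
  intro lam hlam β hβ
  obtain ⟨T, hT, -⟩ := hss lam hlam β hβ
  have hinj := hβ.injective
  have hon : ∀ f n, ‖xs (β n) (T f)‖ = ‖xs n f‖ := fun f n => by
    have : (xs (β n)).comp T = lam n • xs n := hb.ext fun k => by
      simp only [ContinuousLinearMap.comp_apply, hT, map_smul, smul_apply, hb.coord_apply,
        hinj.eq_iff]
      split_ifs with hnk
      · rw [hnk]
      · simp
    have := congrArg (fun S : X →L[𝕜] 𝕜 => ‖S f‖) this
    simpa [hlam] using this
  have hoff : ∀ f j, j ∉ Set.range β → ‖xs j (T f)‖ = 0 := fun f j hj => by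
    have : (xs j).comp T = 0 := hb.ext fun k => by
      have : j ≠ β k := fun hjk => hj ⟨k, hjk.symm⟩
      simp [hT, hb.coord_apply, this]
    have := congrArg (fun S : X →L[𝕜] 𝕜 => ‖S f‖) this
    simpa using this
  refine ⟨T, hT, fun f => ?_, fun f => ?_⟩ <;> rw [one_mul]
  · refine hM.testerNorm_le_testerNorm h fun g hg => ?_
    obtain ⟨k, A, F, b⟩ := g
    refine ⟨⟨k, A.preimage β hinj.injOn, F.preimage β hinj.injOn, fun n => b (β n)⟩,
      ⟨hg.one_le, ?_, hpull b hg.mem β hβ, fun n => hg.le (β n)⟩, le_of_eq ?_⟩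
    · refine le_trans (Finset.card_le_card_of_injOn β (fun n hn => ?_) hinj.injOn) hg.card_le
      simpa using hn
    · have hset : F.preimage β hinj.injOn \ A.preimage β hinj.injOn
          = (F \ A).preimage β hinj.injOn := by ext n; simp
      simp only [Tester.val, hset]
      rw [← Finset.sum_preimage β A hinj.injOn _ fun j _ hj => hoff f j hj,
        ← Finset.sum_preimage β (F \ A) hinj.injOn _ fun j _ hj => by rw [hoff f j hj, mul_zero]]
      simp only [hon]
  · refine hM.testerNorm_le_testerNorm h fun g hg => ?_
    obtain ⟨k, A, F, b⟩ := g
    refine ⟨⟨k, A.image β, F.image β, Function.extend β b 0⟩,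
      ⟨hg.one_le, Finset.card_image_le.trans hg.card_le, hpush b hg.mem β hβ, fun n => ?_⟩,
      le_of_eq ?_⟩
    · by_cases hn : ∃ j, β j = n
      · obtain ⟨j, rfl⟩ := hn
        dsimp only
        rw [hinj.extend_apply]; exact hg.le j
      · dsimp only
        rw [Function.extend_apply' _ _ _ hn]
        exact mul_nonneg h.eta_pos.le (h.div_nonneg hg.one_le)
    · simp only [Tester.val]
      rw [← Finset.image_sdiff _ _ hinj, Finset.sum_image hinj.injOn, Finset.sum_image hinj.injOn]
      simp only [hon, hinj.extend_apply]

end TesterBound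

/-- The coordinatewise moduli of functionals of norm at most `ε`, made invariant under partial
increasing relabellings. -/
def spreadBall (xs : ℕ → X →L[𝕜] 𝕜) (ε : ℝ) : Set (ℕ → ℝ) :=
  {b | (∀ n, 0 ≤ b n) ∧ ∀ (F : Finset ℕ) (p q : ℕ → ℕ), StrictMonoOn p F → StrictMonoOn q F →
    ∀ f : X, ∑ i ∈ F, b (q i) * ‖xs (p i) f‖ ≤ ε * ‖f‖}

lemma zero_mem_spreadBall {ε : ℝ} (hε : 0 ≤ ε) : (fun _ => 0) ∈ spreadBall xs ε := by
  refine ⟨fun _ => le_rfl, fun F p q _ _ f => ?_⟩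
  simp only [zero_mul, Finset.sum_const_zero]
  positivity

lemma comp_mem_spreadBall {ε : ℝ} {b : ℕ → ℝ} (hb : b ∈ spreadBall xs ε) {β : ℕ → ℕ}
    (hβ : StrictMono β) : (fun n => b (β n)) ∈ spreadBall xs ε :=
  ⟨fun _ => hb.1 _, fun F p q hp hq f => hb.2 F p (β ∘ q) hp (hβ.comp_strictMonoOn hq) f⟩

lemma extend_mem_spreadBall {ε : ℝ} {b : ℕ → ℝ} (hb : b ∈ spreadBall xs ε) {β : ℕ → ℕ}
    (hβ : StrictMono β) : Function.extend β b 0 ∈ spreadBall xs ε := by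
  classical
  have hinj := hβ.injective
  refine ⟨fun n => ?_, fun F p q hp hq f => ?_⟩
  · by_cases hn : ∃ j, β j = n
    · obtain ⟨j, rfl⟩ := hn
      rw [hinj.extend_apply]; exact hb.1 j
    · rw [Function.extend_apply' _ _ _ hn]; exact le_rfl
  · set F' := F.filter (fun i => ∃ j, β j = q i) with hF'
    have hsub : F' ⊆ F := Finset.filter_subset _ _
    have hinv : ∀ i ∈ F', β (Function.invFun β (q i)) = q i := fun i hi =>
      Function.invFun_eq (Finset.mem_filter.1 hi).2
    have h1 := hb.2 F' p (fun i => Function.invFun β (q i)) (hp.mono (by exact_mod_cast hsub))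
      (fun i hi j hj hij => by
        rw [← hβ.lt_iff_lt, hinv i hi, hinv j hj]
        exact hq (hsub hi) (hsub hj) hij) f
    refine le_trans (le_of_eq ?_) h1
    rw [← Finset.sum_subset hsub]
    · refine Finset.sum_congr rfl fun i hi => ?_
      conv_lhs => rw [← hinv i hi, hinj.extend_apply]
    · intro i hi hi'
      rw [Function.extend_apply' _ _ _ fun hc => hi' (Finset.mem_filter.2 ⟨hi, hc⟩)]
      simp

variable {K : ℝ}

lemma PartialSpreadBound.exists_norm_sub_greedyProj_lt (hK : PartialSpreadBound x xs K)
    (hb : IsBasis x xs) (f : X) {δ : ℝ} (hδ : 0 < δ) :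
    ∃ P : Finset ℕ, ‖f - greedyProj x xs P f‖ < δ := by
  have hK0 := hK.pos hb
  obtain ⟨g, hg, hfg⟩ := Metric.mem_closure_iff.1 (hb.dense f) (δ / (1 + K)) (by positivity)
  obtain ⟨c, rfl⟩ := Finsupp.mem_span_range_iff_exists_finsupp.1 hg
  rw [dist_eq_norm, lt_div_iff₀ (by positivity)] at hfg
  refine ⟨c.support, lt_of_le_of_lt ?_ hfg⟩
  set g := c.sum fun i a => a • x i with hgdef
  have hPg : greedyProj x xs c.support g = g := by
    have : ∀ n ∈ c.support, xs n g • x n = c n • x n := fun n hn => by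
      rw [hgdef, Finsupp.sum, hb.coord_sum c.support c, if_pos hn]
    rw [greedyProj, Finset.sum_congr rfl this, hgdef, Finsupp.sum]
  have hsub : f - greedyProj x xs c.support f
      = (f - g) - greedyProj x xs c.support (f - g) := by
    have : greedyProj x xs c.support (f - g)
        = greedyProj x xs c.support f - greedyProj x xs c.support g := by
      simp only [greedyProj, map_sub, sub_smul, Finset.sum_sub_distrib]
    rw [this, hPg]; abel
  rw [hsub]
  have := norm_sub_le (f - g) (greedyProj x xs c.support (f - g))
  have := hK.norm_greedyProj_le c.support (f - g)
  linarith

lemma TesterBound.lower {M ε : ℝ} (hε : 0 < ε) (hM : TesterBound σ η (spreadBall xs ε) xs M)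
    (h : Compatible σ η (spreadBall xs ε)) (hK : PartialSpreadBound x xs K) (hb : IsBasis x xs)
    (f : X) : ε / K * ‖f‖ ≤ testerNorm σ η (spreadBall xs ε) xs f := by
  have hK0 := hK.pos hb
  have hc : 0 < ε / K := div_pos hε hK0
  have hproj : ∀ P : Finset ℕ, ε / K * ‖greedyProj x xs P f‖
      ≤ testerNorm σ η (spreadBall xs ε) xs f := by
    intro P
    obtain ⟨y, hy, hyv⟩ := exists_dual_vector'' 𝕜 (greedyProj x xs P f)
    have hmem : (fun n => ε / K * ‖y (x n)‖) ∈ spreadBall xs ε := by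
      refine ⟨fun n => by positivity, fun F p q hp hq f => ?_⟩
      have h1 := mul_le_mul_of_nonneg_left (hK.sum_functional_le F hp hq hy f) hc.le
      rw [Finset.mul_sum] at h1
      simp only [mul_assoc]
      refine h1.trans (le_of_eq ?_)
      field_simp
    have hadm : (⟨1, ∅, P, fun n => ε / K * ‖y (x n)‖⟩ : Tester).Admissible σ η
        (spreadBall xs ε) := by
      refine ⟨le_rfl, by simp, hmem, fun n => ?_⟩
      simpa using h.sum_le _ hmem {n} (Finset.singleton_nonempty n)
    refine le_trans ?_ (hM.le_testerNorm f hadm)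
    simp only [Tester.val, Finset.sum_empty, mul_zero, zero_add, Finset.sdiff_empty, mul_assoc]
    rw [← Finset.mul_sum]
    refine mul_le_mul_of_nonneg_left ?_ hc.le
    have h2 : ‖greedyProj x xs P f‖ = ‖y (greedyProj x xs P f)‖ := by rw [hyv]; simp
    rw [h2, greedyProj, map_sum]
    refine (norm_sum_le _ _).trans (Finset.sum_le_sum fun n _ => ?_)
    rw [map_smul, norm_smul, mul_comm]
  refine le_of_forall_pos_le_add fun δ hδ => ?_
  obtain ⟨P, hP⟩ := hK.exists_norm_sub_greedyProj_lt hb f (δ := δ / (ε / K)) (by positivity)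
  have h1 := hproj P
  have h2 : ‖f‖ ≤ ‖greedyProj x xs P f‖ + ‖f - greedyProj x xs P f‖ := by
    have := norm_add_le (greedyProj x xs P f) (f - greedyProj x xs P f)
    rwa [add_sub_cancel] at this
  have h3 := mul_le_mul_of_nonneg_left (h2.trans (add_le_add_right hP.le _)) hc.le
  rw [mul_add, mul_div_cancel₀ _ hc.ne'] at h3
  linarith

lemma TesterBound.isEquivNorm {M ε : ℝ} (hM0 : 0 < M) (hε : 0 < ε)
    (hM : TesterBound σ η (spreadBall xs ε) xs M)
    (h : Compatible σ η (spreadBall xs ε)) (hK : PartialSpreadBound x xs K) (hb : IsBasis x xs) :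
    IsEquivNorm 𝕜 (testerNorm σ η (spreadBall xs ε) xs) where
  add_le := hM.testerNorm_add_le h
  smul_eq a f := by
    rw [testerNorm, testerNorm, Real.mul_iSup_of_nonneg (norm_nonneg a)]
    refine iSup_congr fun g => ?_
    simp only [Tester.val, map_smul, norm_smul, mul_add, Finset.mul_sum]
    congr 1 <;> exact Finset.sum_congr rfl fun n _ => by ring
  lower := ⟨ε / K, div_pos hε (hK.pos hb), hM.lower hε h hK hb⟩
  upper := ⟨M, hM0, fun f => Real.iSup_le (fun g => hM f g.1 g.2) (by positivity)⟩

lemma PartialSpreadBound.compatible (hK : PartialSpreadBound x xs K) (hb : IsBasis x xs)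
    (hσ : ∀ m, 1 ≤ m → 0 < σ m) (hmono : MonoFrom1 σ) (hdual : DualMonoFrom1 σ) {D : ℝ}
    (hD : 0 < D) (hequiv : ∀ m, 1 ≤ m → fundFun 𝕜 x m ≤ D * σ m) (hη : 0 < η) (hη1 : η ≤ 1)
    (hlower : ∀ m, 1 ≤ m → 3 * η * (σ (m + 1) / (m + 1 : ℕ)) ≤ σ (m + 1) - σ m) :
    Compatible σ η (spreadBall xs (η / D)) where
  pos := hσ
  mono := hmono
  dual := hdual
  eta_pos := hη
  eta_le := hη1
  lower := hlower
  nonneg _ hb' := hb'.1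
  solid b hb' b' h0 hle := ⟨h0, fun F p q hp hq f => (Finset.sum_le_sum fun _ _ =>
    mul_le_mul_of_nonneg_right (hle _) (norm_nonneg _)).trans (hb'.2 F p q hp hq f)⟩
  sum_le b hb' A hA := by
    have h1 := hb'.2 A id id strictMonoOn_id strictMonoOn_id (∑ n ∈ A, (1 : 𝕜) • x n)
    have h2 : ∑ i ∈ A, b (id i) * ‖xs (id i) (∑ n ∈ A, (1 : 𝕜) • x n)‖ = ∑ i ∈ A, b i := by
      refine Finset.sum_congr rfl fun i hi => ?_
      rw [id, hb.coord_sum A (fun _ => (1 : 𝕜)), if_pos hi, norm_one, mul_one]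
    have h3 := (hK.le_fundFun hb (A := A) le_rfl (ε := fun _ => (1 : 𝕜)) (by simp)).trans
      (hequiv A.card hA.card_pos)
    rw [h2] at h1
    refine h1.trans ((mul_le_mul_of_nonneg_left h3 (by positivity)).trans (le_of_eq ?_))
    field_simp

lemma PartialSpreadBound.testerBound (hK : PartialSpreadBound x xs K) (hb : IsBasis x xs)
    {D ε : ℝ} (hD : 0 < D) (hequiv : ∀ m, 1 ≤ m → σ m ≤ D * fundFun 𝕜 x m)
    (h : Compatible σ η (spreadBall xs ε)) :
    TesterBound σ η (spreadBall xs ε) xs (2 * D * K ^ 2 + ε) := by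
  intro f g hg
  obtain ⟨k, A, F, b⟩ := g
  have hK0 := hK.pos hb
  have h1 : ∑ n ∈ F \ A, b n * ‖xs n f‖ ≤ ε * ‖f‖ :=
    hg.mem.2 (F \ A) id id strictMonoOn_id strictMonoOn_id f
  have h2 : σ k / k * ∑ n ∈ A, ‖xs n f‖ ≤ 2 * D * K ^ 2 * ‖f‖ := by
    rcases A.eq_empty_or_nonempty with rfl | hA
    · simp only [Finset.sum_empty, mul_zero]; positivity
    have hA0 : (0 : ℝ) < A.card := by exact_mod_cast hA.card_pos
    have h3 := h.antitone_div hA.card_pos hg.card_le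
    have h4 := hK.fundFun_le hb (Finset.range A.card)
    rw [Finset.card_range] at h4
    have h5 := (hequiv A.card hA.card_pos).trans (mul_le_mul_of_nonneg_left h4 hD.le)
    have h6 := hK.sum_mul_norm_le hA f
    have hs : 0 ≤ ∑ n ∈ A, ‖xs n f‖ := Finset.sum_nonneg fun n _ => norm_nonneg _
    refine (mul_le_mul_of_nonneg_right h3 hs).trans ?_
    rw [div_mul_eq_mul_div, div_le_iff₀ hA0]
    calc σ A.card * ∑ n ∈ A, ‖xs n f‖
        ≤ D * (K * ‖∑ n ∈ Finset.range A.card, x n‖) * ∑ n ∈ A, ‖xs n f‖ :=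
          mul_le_mul_of_nonneg_right h5 hs
      _ = D * K * ((∑ n ∈ A, ‖xs n f‖) * ‖∑ n ∈ Finset.range A.card, x n‖) := by ring
      _ ≤ D * K * (2 * K * A.card * ‖f‖) := mul_le_mul_of_nonneg_left h6 (by positivity)
      _ = _ := by ring
  simp only [Tester.val]
  linarith

end Renorming

/-- Theorem 5.3: a subsymmetric basis of a space with nontrivial
Rademacher cotype admits an isometrically greedy, isometrically bidemocratic, and
isometrically subsymmetric renorming; moreover a good Dini regularization `σ` of the
fundamental function exists and the renorming can be chosen with fundamental function `σ`. -/
theorem subsymmetric_cotype_renorming {𝕜 : Type*} [RCLike 𝕜] {X : Type*}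
    [NormedAddCommGroup X] [NormedSpace 𝕜 X] [CompleteSpace X]
    (x : ℕ → X) (xs : ℕ → X →L[𝕜] 𝕜) (hb : IsBasis x xs)
    (hss : ∃ C : ℝ, 1 ≤ C ∧ SubsymWith 𝕜 (fun f : X => ‖f‖) x C)
    (hcot : NontrivialCotype X) :
    (∃ σ : ℕ → ℝ, GoodDiniReg σ (fundFun 𝕜 x)) ∧
    (∀ σ : ℕ → ℝ, GoodDiniReg σ (fundFun 𝕜 x) →
      ∃ ν : X → ℝ, IsEquivNorm 𝕜 ν ∧ GreedyWith ν x xs 1 ∧ BidemocraticWith ν x xs 1 ∧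
        SubsymWith 𝕜 ν x 1 ∧
        ∀ m : ℕ, 1 ≤ m → fundFunWith 𝕜 ν x m = σ m) := by
  obtain ⟨C₀, hC₀, hss⟩ := hss
  have hK : PartialSpreadBound x xs (C₀ ^ 3) := hss.partialSpreadBound hC₀ hb
  refine ⟨exists_goodDiniReg (fun m hm => hK.fundFun_pos hb hm) (hK.fundFun_mono hb)
    (fun j n hj hjn => hK.fundFun_div_le hb hj hjn) (hK.hasLRP hb hcot), ?_⟩
  rintro σ ⟨⟨-, ⟨C, hC, hdini⟩, ⟨D, hD, hequiv⟩⟩, hσ, hmono, hdual⟩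
  have hC0 : 0 < C := by linarith
  have hD0 : 0 < D := by linarith
  have hη : 0 < 1 / (3 * C) := by positivity
  have hη1 : 1 / (3 * C) ≤ 1 := by rw [div_le_one (by positivity)]; linarith
  have hε : 0 < 1 / (3 * C) / D := by positivity
  have hcomp := hK.compatible hb hσ hmono hdual hD0
    (fun m hm => by
      have := (hequiv m hm).1
      rwa [one_div, ← div_eq_inv_mul, div_le_iff₀ hD0, mul_comm] at this)
    hη hη1 (fun m _ => by
      have := (hdini (m + 1) (by omega)).1
      rw [Nat.add_sub_cancel] at this
      refine le_trans (le_of_eq ?_) this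
      field_simp)
  have hM := hK.testerBound hb hD0 (fun m hm => (hequiv m hm).2) hcomp
  have h0 := zero_mem_spreadBall (xs := xs) hε.le
  exact ⟨_, hM.isEquivNorm (by have := hK.pos hb; positivity) hε hcomp hK hb,
    hM.greedyWith hcomp hb, hM.bidemocraticWith hcomp h0 hb,
    hM.subsymWith hcomp (fun _ h _ hβ => comp_mem_spreadBall h hβ)
      (fun _ h _ hβ => extend_mem_spreadBall h hβ) hb hss,
    fun m hm => hM.fundFunWith_eq hcomp h0 hb hm⟩


end GreedyRenorm
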